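/- arXiv:1505.02925 — 4 statements merged into one kernel-verified Lean document; each statement's English description precedes it below -/
import Mathlib

section
/- (Representation result.) Let (T_{s,t})_{0 ≤ s ≤ t} be a strongly continuous evolution system on a real Banach space B with infinitesimal generators (A_r). Fix 0 ≤ s < t and let F, G : [s,t] → B satisfy: (1) the map r ↦ T_{s,r} G(r) is right-continuous on [s,t); (2) the Bochner integral ∫_s^t T_{s,r} G(r) dr exists; (3) F is continuous on [s,t], right-differentiable on (s,t), F(r) ∈ D(A_r) for all r ∈ (s,t], and (d⁺/dr) F(r) = −A_r F(r) + G(r) for all r ∈ (s,t). Then F(s) = T_{s,t} F(t) − ∫_s^t T_{s,r} G(r) dr. -/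
open MeasureTheory Filter Topology

/-- A uniformly bounded family of operators converging at a point converges along every family of
vectors tending to that point. -/
theorem tendsto_clm_apply_of_norm_le {ι E H : Type*} [NormedAddCommGroup E] [NormedSpace ℝ E]
    [NormedAddCommGroup H] [NormedSpace ℝ H] {l : Filter ι} {φ : ι → E →L[ℝ] H} {x : ι → E}
    {x₀ : E} {y : H} {C : ℝ} (hC : ∀ᶠ i in l, ‖φ i‖ ≤ C)
    (hφ : Tendsto (fun i => φ i x₀) l (𝓝 y)) (hx : Tendsto x l (𝓝 x₀)) :
    Tendsto (fun i => φ i (x i)) l (𝓝 y) := by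
  have hsmall : Tendsto (fun i => φ i (x i - x₀)) l (𝓝 0) := by
    refine squeeze_zero_norm' (a := fun i => C * ‖x i - x₀‖) ?_ ?_
    · filter_upwards [hC] with i hi
      exact (φ i).le_of_opNorm_le hi _
    · simpa using (tendsto_iff_norm_sub_tendsto_zero.1 hx).const_mul C
  simpa using hsmall.add hφ

/-- A right derivative, expressed through difference quotients in the increment. -/
theorem hasDerivWithinAt_Ioi_of_tendsto {E : Type*} [NormedAddCommGroup E] [NormedSpace ℝ E]
    {f : ℝ → E} {f' : E} {r : ℝ}
    (h : Tendsto (fun h : ℝ => h⁻¹ • (f (r + h) - f r)) (𝓝[>] (0 : ℝ)) (𝓝 f')) :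
    HasDerivWithinAt f f' (Set.Ioi r) r := by
  rw [hasDerivWithinAt_iff_tendsto_slope' (by simp)]
  have hsub : Tendsto (fun u : ℝ => u - r) (𝓝[>] r) (𝓝[>] (0 : ℝ)) := by
    refine tendsto_nhdsWithin_iff.2 ⟨?_, ?_⟩
    · have : Tendsto (fun u : ℝ => u - r) (𝓝 r) (𝓝 (r - r)) := tendsto_id.sub_const r
      rw [sub_self] at this
      exact this.mono_left nhdsWithin_le_nhds
    · filter_upwards [self_mem_nhdsWithin] with u hu
      exact sub_pos.2 (Set.mem_Ioi.1 hu)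
  refine (h.comp hsub).congr fun u => ?_
  simp [slope_def_module]

/-- A strongly continuous family of operators is uniformly bounded on a compact set. -/
theorem exists_norm_le_of_strongly_continuousOn {X E H : Type*} [TopologicalSpace X]
    [NormedAddCommGroup E] [NormedSpace ℝ E] [CompleteSpace E] [NormedAddCommGroup H]
    [NormedSpace ℝ H] {φ : X → E →L[ℝ] H} {K : Set X} (hK : IsCompact K)
    (hφ : ∀ f, ContinuousOn (fun x => φ x f) K) : ∃ C, ∀ x ∈ K, ‖φ x‖ ≤ C := by
  obtain ⟨C, hC⟩ := banach_steinhaus (g := fun x : K => φ x) fun f => by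
    obtain ⟨C, hC⟩ := hK.exists_bound_of_continuousOn (hφ f)
    exact ⟨C, fun x => hC x x.2⟩
  exact ⟨C, fun x hx => hC ⟨x, hx⟩⟩

/-- **Representation result.** Let `(T s t)` be a strongly continuous
evolution system on a real Banach space `B` with infinitesimal generators `A_r` (the
norm-limit of `(T r (r+h) g - g)/h` as `h ↓ 0`).  Fix `0 ≤ s < t` and `F, G : ℝ → B`
satisfying: (1) `r ↦ T s r (G r)` is right-continuous on `[s,t)`; (2) the Bochner integral
`∫_s^t T s r (G r) dr` exists; (3) `F` is continuous on `[s,t]`, `F r` belongs to the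
domain of `A_r` for all `r ∈ (s,t]`, and for every `r ∈ (s,t)` the right derivative of `F`
at `r` equals `-A_r F(r) + G(r)`.  Then `F s = T s t (F t) - ∫_s^t T s r (G r) dr`. -/
theorem evolution_system_representation
    {B : Type*} [NormedAddCommGroup B] [NormedSpace ℝ B] [CompleteSpace B]
    (T : ℝ → ℝ → B →L[ℝ] B)
    (hid : ∀ s : ℝ, 0 ≤ s → T s s = ContinuousLinearMap.id ℝ B)
    (hcomp : ∀ s u t : ℝ, 0 ≤ s → s ≤ u → u ≤ t → T s t = (T s u).comp (T u t))
    (hcont : ∀ f : B, ContinuousOn (fun p : ℝ × ℝ => T p.1 p.2 f)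
      {p : ℝ × ℝ | 0 ≤ p.1 ∧ p.1 ≤ p.2})
    (F G : ℝ → B) (s t : ℝ) (hs : 0 ≤ s) (hst : s < t)
    (hGrc : ∀ r ∈ Set.Ico s t,
      ContinuousWithinAt (fun u : ℝ => T s u (G u)) (Set.Ici r) r)
    (hGint : IntervalIntegrable (fun r : ℝ => T s r (G r)) MeasureTheory.volume s t)
    (hFcont : ContinuousOn F (Set.Icc s t))
    (hdom : ∀ r ∈ Set.Ioc s t, ∃ a : B,
      Tendsto (fun h : ℝ => h⁻¹ • (T r (r + h) (F r) - F r)) (𝓝[>] (0 : ℝ)) (𝓝 a))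
    (heq : ∀ r ∈ Set.Ioo s t, ∀ a : B,
      Tendsto (fun h : ℝ => h⁻¹ • (T r (r + h) (F r) - F r)) (𝓝[>] (0 : ℝ)) (𝓝 a) →
      Tendsto (fun h : ℝ => h⁻¹ • (F (r + h) - F r)) (𝓝[>] (0 : ℝ)) (𝓝 (-a + G r))) :
    F s = T s t (F t) - ∫ r in s..t, T s r (G r) := by
  have hTcont (f : B) : ContinuousOn (fun r => T s r f) (Set.Icc s t) :=
    (hcont f).comp (f := fun r => (s, r)) (by fun_prop) fun r hr => ⟨hs, hr.1⟩
  obtain ⟨C, hC⟩ := exists_norm_le_of_strongly_continuousOn isCompact_Icc hTcont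
  have hcts : ContinuousOn (fun r => T s r (F r)) (Set.Icc s t) := fun r hr =>
    tendsto_clm_apply_of_norm_le (eventually_mem_nhdsWithin.mono hC) (hTcont (F r) r hr)
      (hFcont r hr)
  have hderiv : ∀ r ∈ Set.Ioo s t,
      HasDerivWithinAt (fun r => T s r (F r)) (T s r (G r)) (Set.Ioi r) r := by
    intro r hr
    obtain ⟨a, ha⟩ := hdom r ⟨hr.1, hr.2.le⟩
    have hadd : Tendsto (fun h : ℝ => r + h) (𝓝[>] 0) (𝓝 r) := by
      have : Tendsto (fun h : ℝ => r + h) (𝓝 0) (𝓝 (r + 0)) := tendsto_id.const_add r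
      rw [add_zero] at this
      exact this.mono_left nhdsWithin_le_nhds
    have hmem : ∀ᶠ h : ℝ in 𝓝[>] 0, r + h ∈ Set.Icc s t :=
      hadd.eventually (Icc_mem_nhds hr.1 hr.2)
    have hF := tendsto_clm_apply_of_norm_le (φ := fun h : ℝ => T s (r + h))
      (hmem.mono fun h hh => hC _ hh)
      ((hTcont _ r ⟨hr.1.le, hr.2.le⟩).tendsto.comp (tendsto_nhdsWithin_iff.2 ⟨hadd, hmem⟩))
      (heq r hr a ha)
    have hA := ((T s r).continuous.tendsto a).comp ha
    have hsum := hF.add hA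
    rw [← map_add, neg_add_cancel_comm] at hsum
    refine hasDerivWithinAt_Ioi_of_tendsto (hsum.congr' ?_)
    filter_upwards [self_mem_nhdsWithin] with h hh
    have hle : r ≤ r + h := le_add_of_nonneg_right (le_of_lt hh)
    simp only [Function.comp_apply, map_smul, map_sub, hcomp s r (r + h) hs hr.1.le hle,
      ContinuousLinearMap.comp_apply, ← smul_add, sub_add_sub_cancel]
  rw [intervalIntegral.integral_eq_sub_of_hasDeriv_right_of_le hst.le hcts hderiv hGint,
    hid s hs, sub_sub_cancel, ContinuousLinearMap.id_apply]
end

section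
/- (Conditional comparison result.) Let B be a real Banach space equipped with a partial order compatible with the vector space structure (an ordered vector space) whose positive cone {g ∈ B : 0 ≤ g} is closed. Let S = (S_{s,t}) and T = (T_{s,t}) be strongly continuous evolution systems on B with infinitesimal generator families (A_s) and (B_s) respectively, and let F ⊆ B be a set with F ⊆ D(A_s) ∩ D(B_s) for all s > 0. Assume: (1) for every f ∈ F and t > 0, the maps s ↦ T_{s,t} f and s ↦ S_{s,t} f are right-differentiable on (0,t); (2) f ∈ F implies S_{s,t} f ∈ F for all 0 ≤ s ≤ t; (3) A_s f ≤ B_s f for all f ∈ F and s > 0; (4) each operator T_{s,t} is positive, i.e. 0 ≤ g implies 0 ≤ T_{s,t} g; (5) for every f ∈ F and 0 ≤ s < t, the map r ↦ T_{s,r}((B_r − A_r) S_{r,t} f) is right-continuous on [s,t) and Bochner integrable over [s,t]. Then S_{s,t} f ≤ T_{s,t} f for all f ∈ F and all 0 ≤ s ≤ t. -/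
open MeasureTheory Filter Topology

theorem IsCompact.exists_forall_opNorm_le {X E F : Type*} [TopologicalSpace X]
    [NormedAddCommGroup E] [NormedSpace ℝ E] [CompleteSpace E]
    [NormedAddCommGroup F] [NormedSpace ℝ F] {K : Set X} (hK : IsCompact K) {L : X → E →L[ℝ] F}
    (hL : ∀ v, ContinuousOn (fun u => L u v) K) : ∃ M, ∀ u ∈ K, ‖L u‖ ≤ M := by
  obtain ⟨M, hM⟩ := banach_steinhaus (g := fun u : K => L u) fun v => by
    obtain ⟨C, hC⟩ := hK.exists_bound_of_continuousOn (hL v)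
    exact ⟨C, fun u => hC u u.2⟩
  exact ⟨M, fun u hu => hM ⟨u, hu⟩⟩

theorem Filter.Tendsto.clm_apply_of_eventually_opNorm_le {ι E F : Type*}
    [NormedAddCommGroup E] [NormedSpace ℝ E] [NormedAddCommGroup F] [NormedSpace ℝ F]
    {l : Filter ι} {L : ι → E →L[ℝ] F} {v : ι → E} {v₀ : E} {w : F} {M : ℝ}
    (hM : ∀ᶠ u in l, ‖L u‖ ≤ M) (hv : Tendsto v l (𝓝 v₀))
    (hL : Tendsto (fun u => L u v₀) l (𝓝 w)) : Tendsto (fun u => L u (v u)) l (𝓝 w) := by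
  have hdiff : Tendsto (fun u => L u (v u - v₀)) l (𝓝 0) := by
    refine squeeze_zero_norm' (a := fun u => M * ‖v u - v₀‖) ?_ ?_
    · filter_upwards [hM] with u hu using (L u).le_of_opNorm_le hu _
    · simpa using (tendsto_iff_norm_sub_tendsto_zero.1 hv).const_mul M
  simpa using hdiff.add hL

theorem ContinuousOn.clm_apply_of_isCompact {X E F : Type*} [TopologicalSpace X]
    [NormedAddCommGroup E] [NormedSpace ℝ E] [CompleteSpace E]
    [NormedAddCommGroup F] [NormedSpace ℝ F] {K : Set X} (hK : IsCompact K) {L : X → E →L[ℝ] F}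
    {v : X → E} (hL : ∀ w, ContinuousOn (fun u => L u w) K) (hv : ContinuousOn v K) :
    ContinuousOn (fun u => L u (v u)) K := by
  obtain ⟨M, hM⟩ := hK.exists_forall_opNorm_le hL
  exact fun u hu => Tendsto.clm_apply_of_eventually_opNorm_le
    (eventually_mem_nhdsWithin.mono hM) (hv u hu) (hL (v u) u hu)

theorem hasDerivWithinAt_Ioi_iff_tendsto_slope_zero {E : Type*} [NormedAddCommGroup E]
    [NormedSpace ℝ E] {f : ℝ → E} {f' : E} {x : ℝ} :
    HasDerivWithinAt f f' (Set.Ioi x) x ↔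
      Tendsto (fun h : ℝ => h⁻¹ • (f (x + h) - f x)) (𝓝[>] 0) (𝓝 f') := by
  have hmap : 𝓝[>] x = map (x + ·) (𝓝[>] (0 : ℝ)) := by simp
  rw [hasDerivWithinAt_iff_tendsto_slope' Set.self_notMem_Ioi, hmap, tendsto_map'_iff]
  simp [slope, Function.comp_def]

section EvolutionSystem

variable {B : Type*} [NormedAddCommGroup B] [NormedSpace ℝ B] {S T : ℝ → ℝ → B →L[ℝ] B}

theorem EvolutionSystem.continuousOn_right
    (hTcont : ∀ f : B, ContinuousOn (fun p : ℝ × ℝ => T p.1 p.2 f)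
      {p : ℝ × ℝ | 0 ≤ p.1 ∧ p.1 ≤ p.2}) {s t : ℝ} (hs : 0 ≤ s) (f : B) :
    ContinuousOn (fun u => T s u f) (Set.Icc s t) :=
  (hTcont f).comp (f := fun u => (s, u)) (by fun_prop) fun _ hu => ⟨hs, hu.1⟩

theorem EvolutionSystem.continuousOn_left
    (hTcont : ∀ f : B, ContinuousOn (fun p : ℝ × ℝ => T p.1 p.2 f)
      {p : ℝ × ℝ | 0 ≤ p.1 ∧ p.1 ≤ p.2}) {s t : ℝ} (hs : 0 ≤ s) (f : B) :
    ContinuousOn (fun u => T u t f) (Set.Icc s t) :=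
  (hTcont f).comp (f := fun u => (u, t)) (by fun_prop) fun _ hu => ⟨hs.trans hu.1, hu.2⟩

variable [CompleteSpace B]

/-- Near the diagonal, a strongly continuous evolution system acts on convergent families as the
identity does. -/
theorem EvolutionSystem.tendsto_apply_diagonal
    (hTid : ∀ s : ℝ, 0 ≤ s → T s s = ContinuousLinearMap.id ℝ B)
    (hTcont : ∀ f : B, ContinuousOn (fun p : ℝ × ℝ => T p.1 p.2 f)
      {p : ℝ × ℝ | 0 ≤ p.1 ∧ p.1 ≤ p.2}) {r : ℝ} (hr : 0 ≤ r) {v : ℝ → B} {v₀ : B}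
    (hv : Tendsto v (𝓝[>] 0) (𝓝 v₀)) :
    Tendsto (fun h => T r (r + h) (v h)) (𝓝[>] 0) (𝓝 v₀) := by
  have hcont (w : B) : ContinuousOn (fun h => T r (r + h) w) (Set.Icc 0 1) :=
    (hTcont w).comp (f := fun h => (r, r + h)) (by fun_prop) fun h hh =>
      ⟨hr, le_add_of_nonneg_right hh.1⟩
  obtain ⟨M, hM⟩ := isCompact_Icc.exists_forall_opNorm_le hcont
  refine Tendsto.clm_apply_of_eventually_opNorm_le (M := M) ?_ hv ?_
  · filter_upwards [Ioc_mem_nhdsGT (zero_lt_one' ℝ)] with h hh using hM h ⟨hh.1.le, hh.2⟩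
  · have h0 := (hcont v₀ 0 (by simp)).mono_of_mem_nhdsWithin (s := Set.Ioi (0 : ℝ))
      (mem_of_superset (Ioc_mem_nhdsGT (zero_lt_one' ℝ)) Set.Ioc_subset_Icc_self)
    simpa [ContinuousWithinAt, hTid r hr] using h0

/-- Kolmogorov backward equation: the right derivative of `s ↦ S s t f` at `r` is `-A r (S r t f)`
as soon as it exists. -/
theorem EvolutionSystem.rightDeriv_eq_neg_generator
    (hSid : ∀ s : ℝ, 0 ≤ s → S s s = ContinuousLinearMap.id ℝ B)
    (hScomp : ∀ s u t : ℝ, 0 ≤ s → s ≤ u → u ≤ t → S s t = (S s u).comp (S u t))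
    (hScont : ∀ f : B, ContinuousOn (fun p : ℝ × ℝ => S p.1 p.2 f)
      {p : ℝ × ℝ | 0 ≤ p.1 ∧ p.1 ≤ p.2}) {r t : ℝ} (hr : 0 ≤ r) (hrt : r < t) {f a D : B}
    (ha : Tendsto (fun h : ℝ => h⁻¹ • (S r (r + h) (S r t f) - S r t f)) (𝓝[>] 0) (𝓝 a))
    (hD : Tendsto (fun h : ℝ => h⁻¹ • (S (r + h) t f - S r t f)) (𝓝[>] 0) (𝓝 D)) :
    D = -a := by
  refine tendsto_nhds_unique
    (EvolutionSystem.tendsto_apply_diagonal hSid hScont hr hD) (ha.neg.congr' ?_)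
  filter_upwards [Ioc_mem_nhdsGT (sub_pos.2 hrt)] with h hh
  have hcomp : S r (r + h) (S (r + h) t f) = S r t f := by
    rw [hScomp r (r + h) t hr (by linarith [hh.1]) (by linarith [hh.2])]; rfl
  rw [map_smul, map_sub, hcomp, ← smul_neg, neg_sub]

/-- Interpolating between two evolution systems, the right derivative of `r ↦ T s r (S r t f)` is
given by the difference of the generators. -/
theorem EvolutionSystem.hasDerivWithinAt_interpolation
    (hSid : ∀ s : ℝ, 0 ≤ s → S s s = ContinuousLinearMap.id ℝ B)
    (hScomp : ∀ s u t : ℝ, 0 ≤ s → s ≤ u → u ≤ t → S s t = (S s u).comp (S u t))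
    (hScont : ∀ f : B, ContinuousOn (fun p : ℝ × ℝ => S p.1 p.2 f)
      {p : ℝ × ℝ | 0 ≤ p.1 ∧ p.1 ≤ p.2})
    (hTid : ∀ s : ℝ, 0 ≤ s → T s s = ContinuousLinearMap.id ℝ B)
    (hTcomp : ∀ s u t : ℝ, 0 ≤ s → s ≤ u → u ≤ t → T s t = (T s u).comp (T u t))
    (hTcont : ∀ f : B, ContinuousOn (fun p : ℝ × ℝ => T p.1 p.2 f)
      {p : ℝ × ℝ | 0 ≤ p.1 ∧ p.1 ≤ p.2})
    {s r t : ℝ} (hs : 0 ≤ s) (hsr : s ≤ r) (hrt : r < t) {f a b D : B}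
    (ha : Tendsto (fun h : ℝ => h⁻¹ • (S r (r + h) (S r t f) - S r t f)) (𝓝[>] 0) (𝓝 a))
    (hb : Tendsto (fun h : ℝ => h⁻¹ • (T r (r + h) (S r t f) - S r t f)) (𝓝[>] 0) (𝓝 b))
    (hD : Tendsto (fun h : ℝ => h⁻¹ • (S (r + h) t f - S r t f)) (𝓝[>] 0) (𝓝 D)) :
    HasDerivWithinAt (fun u => T s u (S u t f)) (T s r (b - a)) (Set.Ioi r) r := by
  have hr : 0 ≤ r := hs.trans hsr
  obtain rfl := EvolutionSystem.rightDeriv_eq_neg_generator hSid hScomp hScont hr hrt ha hD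
  rw [hasDerivWithinAt_Ioi_iff_tendsto_slope_zero, sub_eq_add_neg]
  refine (((T s r).continuous.tendsto _).comp
    (hb.add (EvolutionSystem.tendsto_apply_diagonal hTid hTcont hr hD))).congr' ?_
  filter_upwards [self_mem_nhdsWithin] with h hh
  have hh' : 0 < h := hh
  have hcomp : T s (r + h) (S (r + h) t f) = T s r (T r (r + h) (S (r + h) t f)) := by
    rw [hTcomp s r (r + h) hs hsr (by linarith)]; rfl
  simp only [Function.comp_apply, hcomp, ← map_sub, ← map_smul]
  rw [map_smul (T r (r + h)), ← smul_add, map_sub (T r (r + h))]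
  congr 2
  abel

end EvolutionSystem

/-- **Conditional comparison result.** Let `B` be a real Banach space with a
partial order compatible with the vector space structure (addition and nonnegative scalar
multiplication preserve the order) whose positive cone is closed.  Let `S`, `T` be strongly
continuous evolution systems on `B` with infinitesimal generator families `(A s)` and
`(Bop s)` respectively, and let `𝓕 ⊆ B` be contained in the domain of `A s` and `Bop s`
for every `s > 0` (encoded by `hA`, `hB`: the generator limits exist and equal `A s f`,
`Bop s f`).  Assume: (1) for `f ∈ 𝓕` the maps `s ↦ T s t f` and `s ↦ S s t f` are
right-differentiable on `(0,t)`; (2) `S` leaves `𝓕` invariant; (3) `A s f ≤ Bop s f` for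
`f ∈ 𝓕`, `s > 0`; (4) each `T s t` is a positive operator; (5) `r ↦ T s r ((Bop r - A r)
(S r t f))` is right-continuous on `[s,t)` and interval integrable on `[s,t]`.  Then
`S s t f ≤ T s t f` for all `f ∈ 𝓕`, `0 ≤ s ≤ t`. -/
theorem conditional_comparison
    {B : Type*} [NormedAddCommGroup B] [NormedSpace ℝ B] [CompleteSpace B]
    [PartialOrder B]
    (hadd : ∀ x y z : B, x ≤ y → x + z ≤ y + z)
    (hsmul : ∀ (c : ℝ) (x : B), 0 ≤ c → 0 ≤ x → 0 ≤ c • x)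
    (hclosed : IsClosed {g : B | 0 ≤ g})
    (S T : ℝ → ℝ → B →L[ℝ] B)
    (hSid : ∀ s : ℝ, 0 ≤ s → S s s = ContinuousLinearMap.id ℝ B)
    (hScomp : ∀ s u t : ℝ, 0 ≤ s → s ≤ u → u ≤ t → S s t = (S s u).comp (S u t))
    (hScont : ∀ f : B, ContinuousOn (fun p : ℝ × ℝ => S p.1 p.2 f)
      {p : ℝ × ℝ | 0 ≤ p.1 ∧ p.1 ≤ p.2})
    (hTid : ∀ s : ℝ, 0 ≤ s → T s s = ContinuousLinearMap.id ℝ B)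
    (hTcomp : ∀ s u t : ℝ, 0 ≤ s → s ≤ u → u ≤ t → T s t = (T s u).comp (T u t))
    (hTcont : ∀ f : B, ContinuousOn (fun p : ℝ × ℝ => T p.1 p.2 f)
      {p : ℝ × ℝ | 0 ≤ p.1 ∧ p.1 ≤ p.2})
    (A Bop : ℝ → B → B) (𝓕 : Set B)
    (hA : ∀ s : ℝ, 0 < s → ∀ f ∈ 𝓕,
      Tendsto (fun h : ℝ => h⁻¹ • (S s (s + h) f - f)) (𝓝[>] (0 : ℝ)) (𝓝 (A s f)))
    (hB : ∀ s : ℝ, 0 < s → ∀ f ∈ 𝓕,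
      Tendsto (fun h : ℝ => h⁻¹ • (T s (s + h) f - f)) (𝓝[>] (0 : ℝ)) (𝓝 (Bop s f)))
    (h1T : ∀ f ∈ 𝓕, ∀ t : ℝ, 0 < t → ∀ s ∈ Set.Ioo (0 : ℝ) t, ∃ D : B,
      Tendsto (fun h : ℝ => h⁻¹ • (T (s + h) t f - T s t f)) (𝓝[>] (0 : ℝ)) (𝓝 D))
    (h1S : ∀ f ∈ 𝓕, ∀ t : ℝ, 0 < t → ∀ s ∈ Set.Ioo (0 : ℝ) t, ∃ D : B,
      Tendsto (fun h : ℝ => h⁻¹ • (S (s + h) t f - S s t f)) (𝓝[>] (0 : ℝ)) (𝓝 D))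
    (h2 : ∀ f ∈ 𝓕, ∀ s t : ℝ, 0 ≤ s → s ≤ t → S s t f ∈ 𝓕)
    (h3 : ∀ s : ℝ, 0 < s → ∀ f ∈ 𝓕, A s f ≤ Bop s f)
    (h4 : ∀ s t : ℝ, 0 ≤ s → s ≤ t → ∀ g : B, 0 ≤ g → 0 ≤ T s t g)
    (h5 : ∀ f ∈ 𝓕, ∀ s t : ℝ, 0 ≤ s → s < t →
      (∀ r ∈ Set.Ico s t, ContinuousWithinAt
        (fun u : ℝ => T s u (Bop u (S u t f) - A u (S u t f))) (Set.Ici r) r) ∧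
      IntervalIntegrable (fun r : ℝ => T s r (Bop r (S r t f) - A r (S r t f)))
        MeasureTheory.volume s t) :
    ∀ f ∈ 𝓕, ∀ s t : ℝ, 0 ≤ s → s ≤ t → S s t f ≤ T s t f := by
  have : IsOrderedAddMonoid B := { add_le_add_left := fun x y h z => hadd x y z h }
  have : PosSMulMono ℝ B := ⟨fun c hc x y hxy => by
    simpa [smul_sub] using hsmul c (y - x) hc (sub_nonneg.2 hxy)⟩
  have : SMulPosMono ℝ B := ⟨fun x hx c d hcd => by
    simpa [sub_smul] using hsmul (d - c) x (sub_nonneg.2 hcd) hx⟩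
  have : IsOrderedModule ℝ B := ⟨⟩
  have : ClosedIciTopology B := ⟨fun x => by
    convert hclosed.preimage (continuous_sub_right x) using 1
    ext y
    simp⟩
  intro f hf s t hs hst
  obtain rfl | hlt := hst.eq_or_lt
  · rw [hSid s hs, hTid s hs]
  have hint := intervalIntegral.integral_eq_sub_of_hasDeriv_right_of_le hst
    (ContinuousOn.clm_apply_of_isCompact isCompact_Icc
      (EvolutionSystem.continuousOn_right hTcont hs)
      (EvolutionSystem.continuousOn_left hScont hs f))
    (fun r hr => by
      have hr0 : 0 < r := hs.trans_lt hr.1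
      have hmem := h2 f hf r t hr0.le hr.2.le
      obtain ⟨D, hD⟩ := h1S f hf t (hr0.trans hr.2) r ⟨hr0, hr.2⟩
      exact EvolutionSystem.hasDerivWithinAt_interpolation hSid hScomp hScont hTid hTcomp hTcont
        hs hr.1.le hr.2 (hA r hr0 _ hmem) (hB r hr0 _ hmem) hD)
    (h5 f hf s t hs hlt).2
  have hnonneg : 0 ≤ ∫ r in s..t, T s r (Bop r (S r t f) - A r (S r t f)) := by
    rw [intervalIntegral.integral_of_le hst]
    refine integral_nonneg_of_ae ((ae_restrict_iff' measurableSet_Ioc).2 (ae_of_all _ fun r hr => ?_))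
    have hr0 : 0 < r := hs.trans_lt hr.1
    exact h4 s r hs hr.1.le _ (sub_nonneg.2 (h3 r hr0 _ (h2 f hf r t hr0.le hr.2)))
  rw [hint, hSid t (hs.trans hst), hTid s hs] at hnonneg
  exact sub_nonneg.1 hnonneg
end

section
/- (Completeness of the modified L^p space.) Let ν be a σ-finite Borel measure on ℝ^d, 1 ≤ p < ∞ and ρ ≥ 0. Then (\bar L^p_ρ(ν), ‖·‖*_{p,ρ}) is complete: for every sequence (f_j) of measurable functions with f_j ∈ \bar L^p_ρ(ν) which is Cauchy with respect to ‖·‖*_{p,ρ}, there exists a measurable function f ∈ \bar L^p_ρ(ν) such that ‖f_j − f‖*_{p,ρ} → 0 as j → ∞. -/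
open MeasureTheory Filter Topology ENNReal

/-- The modified `L^p` norm
`‖f‖*_{p,ρ} = sup_y (1+‖y‖)^{-ρ/p} (∫ |f(x+y)|^p dν(x))^{1/p}`, valued in `ℝ≥0∞`. -/
noncomputable def starNorm {d : ℕ} (ν : Measure (EuclideanSpace ℝ (Fin d))) (p ρ : ℝ)
    (f : EuclideanSpace ℝ (Fin d) → ℝ) : ℝ≥0∞ :=
  ⨆ y : EuclideanSpace ℝ (Fin d),
    ENNReal.ofReal ((1 + ‖y‖) ^ (-ρ / p)) *
      (∫⁻ x, (‖f (x + y)‖₊ : ℝ≥0∞) ^ p ∂ν) ^ (1 / p)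

theorem ofReal_weight_ne_zero {d : ℕ} (p ρ : ℝ) (y : EuclideanSpace ℝ (Fin d)) :
    ENNReal.ofReal ((1 + ‖y‖) ^ (-ρ / p)) ≠ 0 := by
  have : 0 < (1 + ‖y‖) ^ (-ρ / p) := by positivity
  simpa using this

theorem starNorm_eq_iSup_eLpNorm {d : ℕ} (ν : Measure (EuclideanSpace ℝ (Fin d))) {p : ℝ}
    (ρ : ℝ) (hp : 0 < p) (f : EuclideanSpace ℝ (Fin d) → ℝ) :
    starNorm ν p ρ f = ⨆ y : EuclideanSpace ℝ (Fin d),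
      ENNReal.ofReal ((1 + ‖y‖) ^ (-ρ / p)) *
        eLpNorm (fun x => f (x + y)) (ENNReal.ofReal p) ν := by
  refine iSup_congr fun y => ?_
  rw [eLpNorm_eq_lintegral_rpow_enorm_toReal (by simpa using hp) ENNReal.ofReal_ne_top,
    ENNReal.toReal_ofReal hp.le]
  rfl

theorem eLpNorm_translate_le {d : ℕ} {ν : Measure (EuclideanSpace ℝ (Fin d))} {p ρ : ℝ}
    (hp : 0 < p) {f : EuclideanSpace ℝ (Fin d) → ℝ} {C : ℝ≥0∞} (hf : starNorm ν p ρ f ≤ C)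
    (y : EuclideanSpace ℝ (Fin d)) :
    eLpNorm (fun x => f (x + y)) (ENNReal.ofReal p) ν ≤
      (ENNReal.ofReal ((1 + ‖y‖) ^ (-ρ / p)))⁻¹ * C := by
  rw [starNorm_eq_iSup_eLpNorm ν ρ hp] at hf
  exact (ENNReal.mul_le_iff_le_inv (ofReal_weight_ne_zero p ρ y) ENNReal.ofReal_ne_top).1
    ((le_iSup _ y).trans hf)

theorem starNorm_sub_le {d : ℕ} (ν : Measure (EuclideanSpace ℝ (Fin d))) {p : ℝ} (ρ : ℝ)
    (hp : 1 ≤ p) {f g : EuclideanSpace ℝ (Fin d) → ℝ} (hf : Measurable f) (hg : Measurable g) :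
    starNorm ν p ρ (f - g) ≤ starNorm ν p ρ f + starNorm ν p ρ g := by
  simp only [starNorm_eq_iSup_eLpNorm ν ρ (zero_lt_one.trans_le hp)]
  refine iSup_le fun y => ?_
  have hsub : eLpNorm (fun x => (f - g) (x + y)) (ENNReal.ofReal p) ν ≤
      eLpNorm (fun x => f (x + y)) (ENNReal.ofReal p) ν +
        eLpNorm (fun x => g (x + y)) (ENNReal.ofReal p) ν :=
    eLpNorm_sub_le (hf.comp (measurable_add_const y)).aestronglyMeasurable
      (hg.comp (measurable_add_const y)).aestronglyMeasurable (by simpa using hp)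
  refine (mul_le_mul_right hsub _).trans ?_
  rw [mul_add]
  exact add_le_add (le_iSup_of_le y le_rfl) (le_iSup_of_le y le_rfl)

/-- Fatou's lemma for the modified norm. -/
theorem starNorm_le_of_ae_tendsto {d : ℕ} {ν : Measure (EuclideanSpace ℝ (Fin d))} {p ρ : ℝ}
    (hp : 0 < p) {f : ℕ → EuclideanSpace ℝ (Fin d) → ℝ} {g : EuclideanSpace ℝ (Fin d) → ℝ}
    (hf : ∀ n, Measurable (f n))
    (hlim : ∀ y, ∀ᵐ x ∂ν, Tendsto (fun n => f n (x + y)) atTop (𝓝 (g (x + y))))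
    {C : ℝ≥0∞} (hC : ∀ᶠ n in atTop, starNorm ν p ρ (f n) ≤ C) :
    starNorm ν p ρ g ≤ C := by
  rw [starNorm_eq_iSup_eLpNorm ν ρ hp]
  refine iSup_le fun y => ?_
  rw [ENNReal.mul_le_iff_le_inv (ofReal_weight_ne_zero p ρ y) ENNReal.ofReal_ne_top]
  refine (Lp.eLpNorm_lim_le_liminf_eLpNorm
    (fun n => ((hf n).comp (measurable_add_const y)).aestronglyMeasurable) _ (hlim y)).trans ?_
  exact liminf_le_of_frequently_le'
    (hC.mono fun n hn => eLpNorm_translate_le hp hn y).frequently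

/-- A sequence which is rapidly Cauchy for the modified norm converges almost everywhere after
every translation. -/
theorem ae_exists_tendsto_of_starNorm_sub_le {d : ℕ} {ν : Measure (EuclideanSpace ℝ (Fin d))}
    {p ρ : ℝ} (hp : 1 ≤ p) {f : ℕ → EuclideanSpace ℝ (Fin d) → ℝ} (hf : ∀ n, Measurable (f n))
    (hcauchy : ∀ N n m, N ≤ n → N ≤ m →
      starNorm ν p ρ (f n - f m) ≤ ENNReal.ofReal ((1 / 2) ^ (N + 1)))
    (y : EuclideanSpace ℝ (Fin d)) :
    ∀ᵐ x ∂ν, ∃ l, Tendsto (fun n => f n (x + y)) atTop (𝓝 l) := by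
  set w := ENNReal.ofReal ((1 + ‖y‖) ^ (-ρ / p))
  have hw0 : w ≠ 0 := ofReal_weight_ne_zero p ρ y
  have hwt : w ≠ ∞ := ENNReal.ofReal_ne_top
  refine Lp.ae_tendsto_of_cauchy_eLpNorm (p := ENNReal.ofReal p)
    (B := fun N => w⁻¹ * ENNReal.ofReal ((1 / 2) ^ N))
    (fun n => ((hf n).comp (measurable_add_const y)).aestronglyMeasurable) (by simpa using hp)
    ?_ fun N n m hn hm => ?_
  · rw [ENNReal.tsum_mul_left]
    exact ENNReal.mul_ne_top (ENNReal.inv_ne_top.2 hw0) summable_geometric_two.tsum_ofReal_ne_top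
  · refine (eLpNorm_translate_le (zero_lt_one.trans_le hp) (hcauchy N n m hn hm) y).trans_lt ?_
    refine ENNReal.mul_lt_mul_right (ENNReal.inv_ne_zero.2 hwt) (ENNReal.inv_ne_top.2 hw0) ?_
    rw [ENNReal.ofReal_lt_ofReal_iff (by positivity)]
    exact pow_lt_pow_right_of_lt_one₀ (by norm_num) (by norm_num) (Nat.lt_succ_self N)

/-- **completeness of the modified `L^p` space.** Let `ν` be a σ-finite
Borel measure on `ℝ^d`, `1 ≤ p < ∞` and `ρ ≥ 0`.  Every sequence of measurable functions
in `L̄^p_ρ(ν)` (i.e. `p`-integrable w.r.t. `ν` and with finite modified norm) which is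
Cauchy for `‖·‖*_{p,ρ}` converges in `‖·‖*_{p,ρ}` to some measurable `g ∈ L̄^p_ρ(ν)`. -/
theorem modified_Lp_complete {d : ℕ}
    (ν : Measure (EuclideanSpace ℝ (Fin d))) [SigmaFinite ν]
    (p ρ : ℝ) (hp : 1 ≤ p) (hρ : 0 ≤ ρ)
    (f : ℕ → EuclideanSpace ℝ (Fin d) → ℝ)
    (hmeas : ∀ j, Measurable (f j))
    (hint : ∀ j, (∫⁻ x, (‖f j x‖₊ : ℝ≥0∞) ^ p ∂ν) < ∞)
    (hfin : ∀ j, starNorm ν p ρ (f j) < ∞)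
    (hcauchy : ∀ ε : ℝ, 0 < ε → ∃ N : ℕ, ∀ j k : ℕ, N ≤ j → N ≤ k →
      starNorm ν p ρ (f j - f k) ≤ ENNReal.ofReal ε) :
    ∃ g : EuclideanSpace ℝ (Fin d) → ℝ, Measurable g ∧
      (∫⁻ x, (‖g x‖₊ : ℝ≥0∞) ^ p ∂ν) < ∞ ∧ starNorm ν p ρ g < ∞ ∧
      Tendsto (fun j => starNorm ν p ρ (f j - g)) atTop (𝓝 0) := by
  have hp0 : 0 < p := zero_lt_one.trans_le hp
  have hsubseq : ∀ n : ℕ, ∀ᶠ N in atTop, ∀ j k : ℕ, N ≤ j → N ≤ k →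
      starNorm ν p ρ (f j - f k) ≤ ENNReal.ofReal ((1 / 2) ^ (n + 1)) := fun n => by
    obtain ⟨N, hN⟩ := hcauchy ((1 / 2) ^ (n + 1)) (by positivity)
    filter_upwards [eventually_ge_atTop N] with M hM j k hj hk
    exact hN j k (hM.trans hj) (hM.trans hk)
  obtain ⟨φ, hφ, hφcauchy⟩ := extraction_forall_of_eventually hsubseq
  let g : EuclideanSpace ℝ (Fin d) → ℝ := fun x => limUnder atTop fun n => f (φ n) x
  have hg : Measurable g :=
    (StronglyMeasurable.limUnder fun n => (hmeas (φ n)).stronglyMeasurable).measurable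
  have hlim : ∀ y, ∀ᵐ x ∂ν, Tendsto (fun n => f (φ n) (x + y)) atTop (𝓝 (g (x + y))) := by
    intro y
    filter_upwards [ae_exists_tendsto_of_starNorm_sub_le hp (fun n => hmeas (φ n))
      (fun N n m hn hm => hφcauchy N _ _ (hφ.monotone hn) (hφ.monotone hm)) y] with x hx
    exact tendsto_nhds_limUnder hx
  have hclose : ∀ ε : ℝ, 0 < ε → ∃ N : ℕ, ∀ j, N ≤ j →
      starNorm ν p ρ (f j - g) ≤ ENNReal.ofReal ε := by
    intro ε hε
    obtain ⟨N, hN⟩ := hcauchy ε hε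
    refine ⟨N, fun j hj => starNorm_le_of_ae_tendsto hp0 (f := fun n => f j - f (φ n))
      (fun n => (hmeas j).sub (hmeas (φ n))) (fun y => ?_) ?_⟩
    · filter_upwards [hlim y] with x hx
      exact hx.const_sub _
    · filter_upwards [eventually_ge_atTop N] with n hn
      exact hN j (φ n) hj (hn.trans (hφ.id_le n))
  have hgfin : starNorm ν p ρ g < ∞ := by
    obtain ⟨N, hN⟩ := hclose 1 one_pos
    have h := starNorm_sub_le ν ρ hp (hmeas N) ((hmeas N).sub hg)
    rw [show f N - (f N - g) = g from sub_sub_cancel (f N) g] at h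
    exact h.trans_lt
      (ENNReal.add_lt_top.2 ⟨hfin N, (hN N le_rfl).trans_lt ENNReal.ofReal_lt_top⟩)
  refine ⟨g, hg, ?_, hgfin, ?_⟩
  · have h : (∫⁻ x, (‖g x‖₊ : ℝ≥0∞) ^ p ∂ν) ^ (1 / p) ≤ starNorm ν p ρ g :=
      le_iSup_of_le 0 (by simp)
    exact (ENNReal.rpow_lt_top_iff_of_pos (by positivity)).1 (h.trans_lt hgfin)
  · refine ENNReal.tendsto_nhds_zero.2 fun ε hε => ?_
    obtain ⟨δ, hδ, hδε⟩ := ENNReal.lt_iff_exists_nnreal_btwn.1 hε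
    obtain ⟨N, hN⟩ := hclose δ (by exact_mod_cast hδ)
    filter_upwards [eventually_ge_atTop N] with j hj
    exact (hN j hj).trans (by simpa using hδε.le)
end

section
/- (The jump part of the generator maps \bar W^2(ν) into \bar L^2_2(ν), one-dimensional case.) Let ν be a finite Borel measure on ℝ with ∫_ℝ (1 + |x|)^2 dν(x) < ∞. Let F be a Borel measure on ℝ \ {0} with ∫ (1 ∧ |y|^2) dF(y) < ∞ and ∫_{|y| ≥ 1} |y|^2 dF(y) < ∞. Let f : ℝ → ℝ be twice continuously differentiable with ‖f‖*_{2,2} < ∞, ‖f'‖*_{2,2} < ∞ and ‖f''‖*_{2,2} < ∞, and with f'' bounded. Then the function G^J f(x) := ∫_ℝ (f(x+y) − f(x) − f'(x) · y · 1_{{|y| < 1}}(y)) dF(y) is well defined and satisfies ‖G^J f‖*_{2,2} < ∞, i.e. G^J f ∈ \bar L^2_2(ν). -/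
open MeasureTheory Filter Topology ENNReal

/-- The modified `L^p` norm on `ℝ`:
`‖f‖*_{p,ρ} = sup_z (1+|z|)^{-ρ/p} (∫ |f(x+z)|^p dν(x))^{1/p}`, valued in `ℝ≥0∞`.
For `p = ρ = 2` this is `sup_z (1+|z|)⁻¹ (∫ |f(x+z)|² dν(x))^{1/2}`. -/
noncomputable def starNormR (ν : Measure ℝ) (p ρ : ℝ) (f : ℝ → ℝ) : ℝ≥0∞ :=
  ⨆ z : ℝ, ENNReal.ofReal ((1 + |z|) ^ (-ρ / p)) *
    (∫⁻ x, (‖f (x + z)‖₊ : ℝ≥0∞) ^ p ∂ν) ^ (1 / p)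

theorem abs_deriv_add_sub_le {f : ℝ → ℝ} (hf : ContDiff ℝ 2 f) {C : ℝ}
    (hC : ∀ x, |deriv (deriv f) x| ≤ C) (x t : ℝ) :
    |deriv f (x + t) - deriv f x| ≤ C * |t| := by
  have hd : Differentiable ℝ (deriv f) :=
    ((contDiff_succ_iff_deriv (n := 1)).1 hf).2.2.differentiable (by norm_num)
  have h := convex_univ.norm_image_sub_le_of_norm_deriv_le (𝕜 := ℝ) (f := deriv f) (C := C)
    (fun z _ => hd z) (fun z _ => hC z) (Set.mem_univ x) (Set.mem_univ (x + t))
  simpa using h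

theorem abs_taylor_remainder_le {f : ℝ → ℝ} (hf : ContDiff ℝ 2 f) {C : ℝ}
    (hC : ∀ x, |deriv (deriv f) x| ≤ C) (x y : ℝ) :
    |f (x + y) - f x - deriv f x * y| ≤ C * y ^ 2 := by
  have hC0 : 0 ≤ C := (abs_nonneg _).trans (hC 0)
  have hd : Differentiable ℝ f := hf.differentiable (by norm_num)
  have hg : ∀ t ∈ Metric.closedBall (0 : ℝ) |y|,
      HasDerivWithinAt (fun t => f (x + t) - deriv f x * t) (deriv f (x + t) - deriv f x)
        (Metric.closedBall (0 : ℝ) |y|) t := by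
    intro t _
    have h1 : HasDerivAt (fun t => f (x + t)) (deriv f (x + t)) t :=
      (hd (x + t)).hasDerivAt.comp_const_add x t
    have h2 : HasDerivAt (fun t : ℝ => deriv f x * t) (deriv f x) t := by
      simpa using (hasDerivAt_id t).const_mul (deriv f x)
    exact (h1.sub h2).hasDerivWithinAt
  have hb : ∀ t ∈ Metric.closedBall (0 : ℝ) |y|,
      ‖deriv f (x + t) - deriv f x‖ ≤ C * |y| := by
    intro t ht
    rw [mem_closedBall_zero_iff, Real.norm_eq_abs] at ht
    exact (abs_deriv_add_sub_le hf hC x t).trans (mul_le_mul_of_nonneg_left ht hC0)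
  have h := (convex_closedBall (0 : ℝ) |y|).norm_image_sub_le_of_norm_hasDerivWithin_le hg hb
    (x := 0) (y := y) (by simp) (by simp)
  have e : C * |y| * |y| = C * y ^ 2 := by rw [mul_assoc, abs_mul_abs_self, sq]
  simp only [add_zero, mul_zero, sub_zero, Real.norm_eq_abs, e] at h
  rwa [sub_right_comm] at h

theorem abs_jump_integrand_le {f : ℝ → ℝ} (hf : ContDiff ℝ 2 f) {C : ℝ}
    (hC : ∀ x, |deriv (deriv f) x| ≤ C) (x y : ℝ) :
    |f (x + y) - f x - (if |y| < 1 then deriv f x * y else 0)| ≤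
      (C + |deriv f x|) * y ^ 2 := by
  have h := abs_taylor_remainder_le hf hC x y
  split_ifs with hy
  · nlinarith [mul_nonneg (abs_nonneg (deriv f x)) (sq_nonneg y)]
  · have hy2 : |y| ≤ y ^ 2 := by
      rw [← sq_abs]
      nlinarith
    have h2 : |deriv f x * y| ≤ |deriv f x| * y ^ 2 := by
      rw [abs_mul]
      exact mul_le_mul_of_nonneg_left hy2 (abs_nonneg _)
    have h3 := abs_add_le (f (x + y) - f x - deriv f x * y) (deriv f x * y)
    rw [sub_add_cancel] at h3
    rw [sub_zero]
    linarith

theorem integrable_sq_of_levy {F : Measure ℝ}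
    (h1 : (∫⁻ y, ENNReal.ofReal (min 1 (y ^ 2)) ∂F) < ∞)
    (h2 : (∫⁻ y in {y : ℝ | 1 ≤ |y|}, ENNReal.ofReal (y ^ 2) ∂F) < ∞) :
    Integrable (fun y : ℝ => y ^ 2) F := by
  have hs : MeasurableSet {y : ℝ | 1 ≤ |y|} :=
    measurableSet_le measurable_const continuous_abs.measurable
  refine ⟨by fun_prop, ?_⟩
  rw [hasFiniteIntegral_iff_ofReal (ae_of_all _ fun y => sq_nonneg y),
    ← lintegral_add_compl _ hs]
  refine ENNReal.add_lt_top.2 ⟨h2, lt_of_le_of_lt ?_ h1⟩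
  refine (setLIntegral_mono' hs.compl fun y hy => ?_).trans (setLIntegral_le_lintegral _ _)
  have hy1 : |y| < 1 := not_le.1 hy
  rw [min_eq_right ((sq_le_one_iff_abs_le_one y).2 hy1.le)]

theorem starNormR_two_two_lt_top_of_linear_growth {ν : Measure ℝ}
    (hν2 : (∫⁻ x, ENNReal.ofReal ((1 + |x|) ^ 2) ∂ν) < ∞) {g : ℝ → ℝ} {A : ℝ}
    (hg : ∀ x, |g x| ≤ A * (1 + |x|)) : starNormR ν 2 2 g < ∞ := by
  have hA : 0 ≤ A := by simpa using (abs_nonneg _).trans (hg 0)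
  set I := ∫⁻ x, ENNReal.ofReal ((1 + |x|) ^ 2) ∂ν
  have key : starNormR ν 2 2 g ≤ ENNReal.ofReal A * I ^ (1 / 2 : ℝ) := by
    refine iSup_le fun z => ?_
    have hz : 0 < 1 + |z| := by positivity
    have hpt : ∀ x, (‖g (x + z)‖₊ : ℝ≥0∞) ^ (2 : ℝ) ≤
        ENNReal.ofReal (A * (1 + |z|)) ^ (2 : ℝ) * ENNReal.ofReal ((1 + |x|) ^ 2) := by
      intro x
      have hx : |g (x + z)| ≤ A * (1 + |z|) * (1 + |x|) := by
        have h : 1 + |x + z| ≤ (1 + |z|) * (1 + |x|) := by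
          nlinarith [abs_add_le x z, mul_nonneg (abs_nonneg x) (abs_nonneg z)]
        calc |g (x + z)| ≤ A * (1 + |x + z|) := hg _
          _ ≤ A * ((1 + |z|) * (1 + |x|)) := mul_le_mul_of_nonneg_left h hA
          _ = _ := by ring
      rw [← enorm_eq_nnnorm, Real.enorm_eq_ofReal_abs, ENNReal.ofReal_pow (by positivity),
        ← ENNReal.rpow_natCast, Nat.cast_ofNat, ← ENNReal.mul_rpow_of_nonneg _ _ zero_le_two,
        ← ENNReal.ofReal_mul (by positivity)]
      exact ENNReal.rpow_le_rpow (ENNReal.ofReal_le_ofReal hx) zero_le_two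
    have hint : (∫⁻ x, (‖g (x + z)‖₊ : ℝ≥0∞) ^ (2 : ℝ) ∂ν) ^ (1 / 2 : ℝ) ≤
        ENNReal.ofReal (A * (1 + |z|)) * I ^ (1 / 2 : ℝ) := by
      refine (ENNReal.rpow_le_rpow (lintegral_mono hpt) (by norm_num)).trans_eq ?_
      rw [lintegral_const_mul' _ _ (ENNReal.rpow_ne_top_of_nonneg zero_le_two ofReal_ne_top),
        ENNReal.mul_rpow_of_nonneg _ _ (by norm_num), ← ENNReal.rpow_mul,
        mul_one_div_cancel two_ne_zero, ENNReal.rpow_one]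
    refine (mul_le_mul_right hint _).trans_eq ?_
    rw [← mul_assoc, ← ENNReal.ofReal_mul (by positivity), neg_div, div_self two_ne_zero,
      Real.rpow_neg_one, mul_left_comm, inv_mul_cancel₀ hz.ne', mul_one]
  exact key.trans_lt (ENNReal.mul_lt_top ofReal_lt_top
    (ENNReal.rpow_lt_top_of_nonneg (by norm_num) hν2.ne))

/-- **the jump part of the generator maps `W̄²(ν)` into `L̄²₂(ν)`, `d = 1`.**
Let `ν` be a finite Borel measure on `ℝ` with `∫ (1+|x|)² dν < ∞`.  Let `F` be a Lévy
measure on `ℝ \ {0}` (i.e. `F {0} = 0` and `∫ (1 ∧ y²) dF < ∞`) with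
`∫_{|y| ≥ 1} y² dF < ∞`.  Let `f : ℝ → ℝ` be twice continuously differentiable with
`‖f‖*₂,₂ < ∞`, `‖f'‖*₂,₂ < ∞`, `‖f''‖*₂,₂ < ∞`, and `f''` bounded.  Then
`G^J f (x) = ∫ (f(x+y) - f(x) - f'(x)·y·1_{|y|<1}) dF(y)` is well defined (the integrand
is `F`-integrable for every `x`) and `‖G^J f‖*₂,₂ < ∞`, i.e. `G^J f ∈ L̄²₂(ν)`. -/
theorem jump_generator_maps_into_modified_L2 (ν : Measure ℝ) [IsFiniteMeasure ν]
    (hν2 : (∫⁻ x, ENNReal.ofReal ((1 + |x|) ^ 2) ∂ν) < ∞)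
    (F : Measure ℝ) (hF0 : F {0} = 0)
    (hFlevy : (∫⁻ y, ENNReal.ofReal (min 1 (y ^ 2)) ∂F) < ∞)
    (hF2 : (∫⁻ y in {y : ℝ | 1 ≤ |y|}, ENNReal.ofReal (y ^ 2) ∂F) < ∞)
    (f : ℝ → ℝ) (hf : ContDiff ℝ 2 f)
    (hfs : starNormR ν 2 2 f < ∞)
    (hf's : starNormR ν 2 2 (deriv f) < ∞)
    (hf''s : starNormR ν 2 2 (deriv (deriv f)) < ∞)
    (hf''b : ∃ C : ℝ, ∀ x, |deriv (deriv f) x| ≤ C) :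
    (∀ x : ℝ, Integrable
      (fun y => f (x + y) - f x - (if |y| < 1 then deriv f x * y else 0)) F) ∧
    starNormR ν 2 2
      (fun x => ∫ y, (f (x + y) - f x - (if |y| < 1 then deriv f x * y else 0)) ∂F)
      < ∞ := by
  obtain ⟨C, hC⟩ := hf''b
  have hC0 : 0 ≤ C := (abs_nonneg _).trans (hC 0)
  have hsq : Integrable (fun y : ℝ => y ^ 2) F := integrable_sq_of_levy hFlevy hF2
  have hdom : ∀ x, Integrable (fun y : ℝ => (C + |deriv f x|) * y ^ 2) F :=
    fun x => hsq.const_mul _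
  refine ⟨fun x => (hdom x).mono' ?_ (ae_of_all _ (abs_jump_integrand_le hf hC x)), ?_⟩
  · have hm : Measurable f := hf.continuous.measurable
    refine Measurable.aestronglyMeasurable (Measurable.sub (by fun_prop) ?_)
    exact Measurable.ite (measurableSet_lt continuous_abs.measurable measurable_const)
      (by fun_prop) measurable_const
  · have hK : 0 ≤ ∫ y, y ^ 2 ∂F := integral_nonneg fun y => sq_nonneg y
    refine starNormR_two_two_lt_top_of_linear_growth hν2
      (A := (C + |deriv f 0|) * ∫ y, y ^ 2 ∂F) fun x => ?_
    have h1 := norm_integral_le_of_norm_le (f := fun y =>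
      f (x + y) - f x - (if |y| < 1 then deriv f x * y else 0)) (hdom x)
      (ae_of_all _ (abs_jump_integrand_le hf hC x))
    rw [integral_const_mul, Real.norm_eq_abs] at h1
    have h2 : |deriv f x| ≤ |deriv f 0| + C * |x| := by
      have h := abs_deriv_add_sub_le hf hC 0 x
      rw [zero_add] at h
      linarith [abs_sub_abs_le_abs_sub (deriv f x) (deriv f 0)]
    refine h1.trans ?_
    rw [mul_right_comm]
    refine mul_le_mul_of_nonneg_right ?_ hK
    nlinarith [mul_nonneg (abs_nonneg (deriv f 0)) (abs_nonneg x)]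
end
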